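/- arXiv:math/0506066 — 2 statements merged into one kernel-verified Lean document; each statement's English description precedes it below -/
import Mathlib

section
/- Let A be a simple finitely generated infinite-dimensional K-algebra. Then fd(A) ≥ 1/2. -/
/- Common definitions: degree of a function, standard finite-dimensional filtrations,
Gelfand-Kirillov dimension, return functions and filter dimensions (V. Bavula,
"Filter dimension"), and the Rentschler–Gabriel (left) Krull dimension via deviation. -/

open Filter

noncomputable section

/-- The degree `γ(f)` (as an extended real) of a function `f : ℕ → ℕ∞`:
`inf { r : ℝ | f i ≤ i ^ r for all sufficiently large i }` (`⊤` if no such `r` exists). -/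
def gammaDeg (f : ℕ → ℕ∞) : EReal :=
  sInf { x : EReal | ∃ r : ℝ, x = (r : EReal) ∧
    ∀ᶠ i in atTop, f i ≤ (⌊(i : ℝ) ^ r⌋₊ : ℕ∞) }

/-- `V` is the degree-one piece of a standard finite-dimensional filtration `{A_i = V ^ i}`
of the `K`-algebra `A`: it is finite-dimensional, contains `1` and generates `A`
(this is the filtration associated with a finite set of algebra generators). -/
structure IsStdFilt (K A : Type) [Field K] [Ring A] [Algebra K A] (V : Submodule K A) :
    Prop where
  one_mem : (1 : A) ∈ V
  fin : FiniteDimensional K V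
  gen : Algebra.adjoin K (V : Set A) = ⊤

/-- The Gelfand-Kirillov dimension `GK(A) = γ(i ↦ dim A_i)` of the algebra `A` w.r.t. the
standard filtration `{A_i = V ^ i}`. -/
def gkAlg (K A : Type) [Field K] [Ring A] [Algebra K A] (V : Submodule K A) : EReal :=
  gammaDeg fun i => (Module.finrank K (V ^ i : Submodule K A) : ℕ∞)

/-- The `K`-subspace `p • W` of the module `M` spanned by products `a • w`, `a ∈ p`, `w ∈ W`. -/
def smulSub (K : Type) [Field K] {A M : Type} [Ring A] [Algebra K A] [AddCommGroup M]
    [Module K M] [Module A M] [IsScalarTower K A M] (p : Submodule K A) (W : Submodule K M) :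
    Submodule K M :=
  Submodule.span K {x : M | ∃ a ∈ p, ∃ w ∈ W, x = a • w}

/-- `W` is a finite-dimensional generating subspace of the `A`-module `M`. -/
def IsGenSub (K A : Type) {M : Type} [Field K] [Ring A] [Algebra K A] [AddCommGroup M]
    [Module K M] [Module A M] [IsScalarTower K A M] (W : Submodule K M) : Prop :=
  FiniteDimensional K W ∧ Submodule.span A (W : Set M) = ⊤

/-- The Gelfand-Kirillov dimension `GK(M) = γ(i ↦ dim M_i)` of the module `M` w.r.t. the
standard filtration `{M_i = V ^ i • W}`. -/
def gkModW (K : Type) [Field K] {A M : Type} [Ring A] [Algebra K A] [AddCommGroup M]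
    [Module K M] [Module A M] [IsScalarTower K A M] (V : Submodule K A) (W : Submodule K M) :
    EReal :=
  gammaDeg fun i => (Module.finrank K (smulSub K (V ^ i) W) : ℕ∞)

/-- The Gelfand-Kirillov dimension of a module, as the infimum over all finite-dimensional
generating subspaces (it agrees with `gkModW` for each of them). -/
def gkMod (K A M : Type) [Field K] [Ring A] [Algebra K A] [AddCommGroup M] [Module K M]
    [Module A M] [IsScalarTower K A M] (V : Submodule K A) : EReal :=
  ⨅ W : {W : Submodule K M // IsGenSub K A W}, gkModW K V W.1

/-- The return function `ν_{F,W}` of the `A`-module `M` associated with the standard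
filtration `F = {V ^ i}` of `A` and the generating subspace `W` of `M`:
`ν(i) = min { j | V ^ j • N ⊇ W for every generating subspace N ⊆ V ^ i • W }`. -/
def retMod (K : Type) [Field K] {A M : Type} [Ring A] [Algebra K A] [AddCommGroup M]
    [Module K M] [Module A M] [IsScalarTower K A M] (V : Submodule K A) (W : Submodule K M)
    (i : ℕ) : ℕ∞ :=
  sInf { j : ℕ∞ | ∃ n : ℕ, j = (n : ℕ∞) ∧ ∀ N : Submodule K M,
      Submodule.span A (N : Set M) = ⊤ → N ≤ smulSub K (V ^ i) W →
      W ≤ smulSub K (V ^ n) N }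

/-- The filter dimension `fd(M) = γ(ν_{F,W})` of the `A`-module `M`. -/
def fdModW (K : Type) [Field K] {A M : Type} [Ring A] [Algebra K A] [AddCommGroup M]
    [Module K M] [Module A M] [IsScalarTower K A M] (V : Submodule K A) (W : Submodule K M) :
    EReal :=
  gammaDeg (retMod K V W)

/-- The return function `ν_F` of a (simple) algebra `A` w.r.t. the standard filtration
`F = {A_i = V ^ i}`: `ν_F(i) = min { j | 1 ∈ A_j a A_j for all 0 ≠ a ∈ A_i }`, where
`A_j a A_j` is the `K`-span of `{ x * a * y | x, y ∈ A_j }`. -/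
def nuFn (K : Type) [Field K] {A : Type} [Ring A] [Algebra K A] (V : Submodule K A)
    (i : ℕ) : ℕ∞ :=
  sInf { j : ℕ∞ | ∃ n : ℕ, j = (n : ℕ∞) ∧ ∀ a ∈ (V ^ i : Submodule K A), a ≠ 0 →
    (1 : A) ∈ Submodule.span K
      {x : A | ∃ u ∈ (V ^ n : Submodule K A), ∃ w ∈ (V ^ n : Submodule K A), x = u * a * w} }

/-- The left return function `λ_F` of a (simple) algebra `A`:
`λ_F(i) = min { j | 1 ∈ A a A_j for all 0 ≠ a ∈ A_i }`, where `A a A_j` is the left ideal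
of `A` generated by the set `a A_j`. -/
def lamFn (K : Type) [Field K] {A : Type} [Ring A] [Algebra K A] (V : Submodule K A)
    (i : ℕ) : ℕ∞ :=
  sInf { j : ℕ∞ | ∃ n : ℕ, j = (n : ℕ∞) ∧ ∀ a ∈ (V ^ i : Submodule K A), a ≠ 0 →
    (1 : A) ∈ Submodule.span A {x : A | ∃ w ∈ (V ^ n : Submodule K A), x = a * w} }

/-- The filter dimension `fd(A) = γ(ν_F)` of a simple finitely generated algebra `A`. -/
def fdAlg (K : Type) [Field K] {A : Type} [Ring A] [Algebra K A] (V : Submodule K A) : EReal :=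
  gammaDeg (nuFn K V)

/-- The left filter dimension `lfd(A) = γ(λ_F)` of a simple finitely generated algebra `A`. -/
def lfdAlg (K : Type) [Field K] {A : Type} [Ring A] [Algebra K A] (V : Submodule K A) : EReal :=
  gammaDeg (lamFn K V)

/-- `DevLE n α` : the deviation of the poset `α` is at most `n`. -/
def DevLE : ℕ → (α : Type) → [inst : Preorder α] → Prop
  | 0, α, _ => ∀ f : ℕ → α, Antitone f → ∀ᶠ i in atTop, ¬ f (i + 1) < f i
  | n + 1, α, _ => ∀ f : ℕ → α, Antitone f →
      ∀ᶠ i in atTop, DevLE n (Set.Icc (f (i + 1)) (f i))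

open Classical in
/-- The left Krull dimension in the sense of Rentschler–Gabriel of the `A`-module `M`:
the deviation of the poset of submodules of `M`, as an extended real (`⊥` for the zero
module, `⊤` if the deviation is not a natural number). For `M = A` this is the left Krull
dimension `K.dim A` of the ring `A`. -/
def kdimE (A M : Type) [Ring A] [AddCommGroup M] [Module A M] : EReal :=
  if Subsingleton M then ⊥
  else sInf { x : EReal | ∃ n : ℕ, x = (n : EReal) ∧ DevLE n (Submodule A M) }

open Module in
theorem aux_dim {K A : Type} [Field K] [Ring A] [Algebra K A] [Nontrivial A]
    (P Q : Submodule K A) [FiniteDimensional K P] [FiniteDimensional K Q]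
    (h : ∀ a ∈ P, a ≠ 0 → (1 : A) ∈ Submodule.span K
      {x : A | ∃ u ∈ Q, ∃ w ∈ Q, x = u * a * w}) :
    finrank K P ≤ finrank K Q ^ 2 := by
  obtain ⟨φ, hφ⟩ : ∃ φ : Module.Dual K A, φ 1 ≠ 0 := by
    by_contra! hc
    exact one_ne_zero ((Module.forall_dual_apply_eq_zero_iff K (1 : A)).1 hc)
  let T : P →ₗ[K] (Q →ₗ[K] Q →ₗ[K] K) :=
    { toFun := fun a => LinearMap.mk₂ K (fun u w : Q => φ ((u : A) * (a : A) * (w : A)))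
        (by intros; simp [add_mul]) (by intros; simp)
        (by intros; simp [mul_add]) (by intros; simp)
      map_add' := by intros; ext; simp [mul_add, add_mul]
      map_smul' := by intros; ext; simp }
  have hT : Function.Injective T := by
    rw [injective_iff_map_eq_zero]
    intro a ha
    by_contra hne
    have h1 := h a a.2 (by simpa using hne)
    have h2 : Submodule.span K {x : A | ∃ u ∈ Q, ∃ w ∈ Q, x = u * (a : A) * w} ≤
        LinearMap.ker φ := by
      rw [Submodule.span_le]
      rintro x ⟨u, hu, w, hw, rfl⟩
      have := congrArg (fun f => f ⟨u, hu⟩ ⟨w, hw⟩) ha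
      simpa [T] using this
    exact hφ (h2 h1)
  have := LinearMap.finrank_le_finrank_of_injective hT
  rwa [Module.finrank_linearMap, Module.finrank_linearMap, Module.finrank_self, mul_one,
    ← sq] at this

theorem aux_fin {K A : Type} [Field K] [Ring A] [Algebra K A]
    (V : Submodule K A) (hV : IsStdFilt K A V) (i : ℕ) :
    FiniteDimensional K (V ^ i : Submodule K A) := by
  have := hV.fin
  exact Module.Finite.iff_fg.2 ((Module.Finite.iff_fg.1 this).pow i)

theorem aux_mono {K A : Type} [Field K] [Ring A] [Algebra K A]
    (V : Submodule K A) (hV : IsStdFilt K A V) : Monotone (fun i : ℕ => V ^ i) := by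
  intro a b hab
  exact pow_le_pow_right₀ (by rw [Submodule.one_le]; exact hV.one_mem) hab

theorem aux_lower {K A : Type} [Field K] [Ring A] [Algebra K A]
    (hinf : ¬ FiniteDimensional K A) (V : Submodule K A) (hV : IsStdFilt K A V) (i : ℕ) :
    i ≤ Module.finrank K (V ^ i : Submodule K A) := by
  have hfin := aux_fin V hV
  have hmono := aux_mono V hV
  induction i with
  | zero => simp
  | succ i ih =>
    refine Nat.succ_le_of_lt (lt_of_le_of_lt ih ?_)
    apply Submodule.finrank_lt_finrank_of_lt
    refine lt_of_le_of_ne (hmono (Nat.le_succ i)) fun heq => hinf ?_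
    have hall : ∀ k, V ^ (i + k) = V ^ i := by
      intro k
      induction k with
      | zero => rfl
      | succ k ihk => rw [← add_assoc, pow_succ, ihk, ← pow_succ, ← heq]
    have h1 : (1 : A) ∈ V ^ i := by
      have := hmono (Nat.zero_le i)
      simp only [pow_zero] at this
      exact Submodule.one_le.1 this
    let S : Subalgebra K A := (V ^ i).toSubalgebra h1 (by
      intro x y hx hy
      rw [← hall i, pow_add]
      exact Submodule.mul_mem_mul hx hy)
    have hS : S = ⊤ := by
      rw [eq_top_iff, ← hV.gen]
      apply Algebra.adjoin_le
      intro x hx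
      change x ∈ V ^ i
      rw [← hall 1]
      have := hmono (Nat.le_add_left 1 i)
      simp only [pow_one] at this
      exact this hx
    have htop : (V ^ i : Submodule K A) = ⊤ := by
      rw [eq_top_iff]
      intro x _
      change x ∈ S
      rw [hS]; trivial
    have := hfin i
    rw [htop] at this
    exact Module.Finite.equiv (Submodule.topEquiv (R := K) (M := A))

theorem aux_growth (d : ℕ → ℕ) (hd : ∀ i, i ≤ d i) (r : ℝ) (hr0 : 0 < r) (hr : r < 1 / 2)
    (N : ℕ) (h : ∀ i ≥ N, d i ≤ d ⌊(i : ℝ) ^ r⌋₊ ^ 2) : False := by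
  have hlogr : Real.log r < 0 := Real.log_neg hr0 (by linarith)
  have hlog2 : 0 < Real.log 2 := Real.log_pos (by norm_num)
  obtain ⟨s, hs0, hs1, hs⟩ : ∃ s : ℝ, 0 < s ∧ s < 1 ∧ 2 * r ^ s = 1 := by
    refine ⟨Real.log 2 / (- Real.log r), by apply div_pos <;> linarith, ?_, ?_⟩
    · rw [div_lt_one (by linarith)]
      have := Real.log_lt_log hr0 hr
      rw [one_div, Real.log_inv] at this
      linarith
    · rw [Real.rpow_def_of_pos hr0]
      have : Real.log r * (Real.log 2 / -Real.log r) = - Real.log 2 := by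
        have hne : Real.log r ≠ 0 := hlogr.ne
        field_simp
      rw [this, Real.exp_neg, Real.exp_log (by norm_num)]
      norm_num
  have hlim : ∀ᶠ i : ℕ in atTop, (2 : ℝ) ≤ (i : ℝ) ^ r :=
    ((tendsto_rpow_atTop hr0).comp tendsto_natCast_atTop_atTop).eventually_ge_atTop 2
  obtain ⟨N', hN'⟩ := eventually_atTop.1 hlim
  obtain ⟨C, hC⟩ : ∃ C : ℝ, ∀ i < N + N', 2 ≤ i →
      Real.log (d i) ≤ C * (Real.log i) ^ s := by
    obtain ⟨C, hC⟩ := ((Finset.range (N + N')).image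
      (fun i : ℕ => Real.log (d i) / (Real.log i) ^ s)).bddAbove
    refine ⟨C, fun i hi h2 => ?_⟩
    have hp : 0 < Real.log i := Real.log_pos (by exact_mod_cast h2)
    rw [← div_le_iff₀ (by positivity)]
    apply hC
    simp only [Finset.coe_image]
    exact ⟨i, by simpa using hi, rfl⟩
  have key : ∀ i : ℕ, 2 ≤ i → Real.log (d i) ≤ max C 0 * (Real.log i) ^ s := by
    intro i
    induction i using Nat.strong_induction_on with
    | _ i ih =>
      intro h2
      have hp : 0 < Real.log i := Real.log_pos (by exact_mod_cast h2)
      by_cases hi : i < N + N'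
      · refine (hC i hi h2).trans ?_
        gcongr
        exact le_max_left _ _
      · have hge := hN' i (by omega)
        have hm2 : 2 ≤ ⌊(i : ℝ) ^ r⌋₊ := Nat.le_floor (by exact_mod_cast hge)
        have hfl : (⌊(i : ℝ) ^ r⌋₊ : ℝ) ≤ (i : ℝ) ^ r := Nat.floor_le (by positivity)
        have hi1 : (1 : ℝ) < i := by exact_mod_cast h2
        have hlt : ⌊(i : ℝ) ^ r⌋₊ < i := by
          have : (i : ℝ) ^ r < (i : ℝ) ^ (1 : ℝ) :=
            Real.rpow_lt_rpow_of_exponent_lt hi1 (by linarith)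
          rw [Real.rpow_one] at this
          exact_mod_cast hfl.trans_lt this
        have hI := ih _ hlt hm2
        have hdi := h i (by omega)
        have hdpos : 0 < d i := by have := hd i; omega
        have e1 : Real.log (d i) ≤ 2 * Real.log (d ⌊(i : ℝ) ^ r⌋₊) := by
          have : Real.log (d i) ≤ Real.log ((d ⌊(i : ℝ) ^ r⌋₊ : ℝ) ^ 2) := by
            apply Real.log_le_log
            · exact_mod_cast hdpos
            · exact_mod_cast hdi
          rwa [Real.log_pow] at this
        have e2 : Real.log (⌊(i : ℝ) ^ r⌋₊ : ℝ) ≤ r * Real.log i := by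
          rw [← Real.log_rpow (by linarith)]
          apply Real.log_le_log _ hfl
          exact_mod_cast (by omega : 0 < ⌊(i : ℝ) ^ r⌋₊)
        have e3 : Real.log (⌊(i : ℝ) ^ r⌋₊ : ℝ) ^ s ≤ r ^ s * Real.log i ^ s := by
          rw [← Real.mul_rpow hr0.le hp.le]
          exact Real.rpow_le_rpow (Real.log_natCast_nonneg _) e2 hs0.le
        have e4 := mul_le_mul_of_nonneg_left e3 (le_max_right C 0)
        calc Real.log (d i) ≤ 2 * (max C 0 * (r ^ s * Real.log i ^ s)) := by linarith
          _ = (2 * r ^ s) * (max C 0 * Real.log i ^ s) := by ring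
          _ = _ := by rw [hs, one_mul]
  have hlim2 : ∀ᶠ i : ℕ in atTop, max C 0 + 1 ≤ (Real.log i) ^ (1 - s) :=
    ((tendsto_rpow_atTop (by linarith : 0 < 1 - s)).comp
      (Real.tendsto_log_atTop.comp tendsto_natCast_atTop_atTop)).eventually_ge_atTop _
  obtain ⟨i, hi, hi2⟩ := (hlim2.and (eventually_ge_atTop 2)).exists
  have hp : 0 < Real.log i := Real.log_pos (by exact_mod_cast hi2)
  have k1 := key i hi2
  have k2 : Real.log i ≤ Real.log (d i) :=
    Real.log_le_log (by exact_mod_cast (by omega : 0 < i)) (by exact_mod_cast hd i)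
  have k3 : Real.log i = Real.log i ^ (1 - s) * Real.log i ^ s := by
    rw [← Real.rpow_add hp]; simp
  have k4 : 0 < Real.log i ^ s := by positivity
  have k5 := mul_le_mul_of_nonneg_right hi k4.le
  linarith

/-- Let `A` be a simple finitely generated infinite-dimensional `K`-algebra.
Then `fd(A) ≥ 1/2`. -/
theorem fd_ge_one_half
    (K A : Type) [Field K] [Ring A] [Algebra K A] [IsSimpleRing A]
    (hinf : ¬ FiniteDimensional K A)
    (V : Submodule K A) (hV : IsStdFilt K A V) :
    ((1 / 2 : ℝ) : EReal) ≤ fdAlg K V := by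
  have hnt : Nontrivial A := inferInstance
  have hfin := aux_fin V hV
  have hmono := aux_mono V hV
  unfold fdAlg gammaDeg
  refine le_sInf ?_
  rintro x ⟨r, rfl, hr⟩
  rw [EReal.coe_le_coe_iff]
  by_contra! hlt
  obtain ⟨N, hN⟩ := eventually_atTop.1 hr
  refine aux_growth (fun i => Module.finrank K (V ^ i : Submodule K A))
    (aux_lower hinf V hV) (max r (1 / 4)) (by positivity)
    (max_lt hlt (by norm_num)) (N + 1) ?_
  intro i hi
  have h1 := hN i (by omega)
  have hne : nuFn K V i < ⊤ := lt_of_le_of_lt h1 (ENat.coe_lt_top _)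
  have hmem : nuFn K V i ∈ { j : ℕ∞ | ∃ n : ℕ, j = (n : ℕ∞) ∧ ∀ a ∈ (V ^ i : Submodule K A),
      a ≠ 0 → (1 : A) ∈ Submodule.span K
      {x : A | ∃ u ∈ (V ^ n : Submodule K A), ∃ w ∈ (V ^ n : Submodule K A),
        x = u * a * w} } := by
    refine csInf_mem ?_
    by_contra hc
    rw [Set.not_nonempty_iff_eq_empty] at hc
    unfold nuFn at hne
    rw [hc, sInf_empty] at hne
    exact lt_irrefl _ hne
  obtain ⟨n, hn, hP⟩ := hmem
  rw [hn, Nat.cast_le] at h1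
  have h2 : n ≤ ⌊(i : ℝ) ^ (max r (1 / 4))⌋₊ := by
    refine h1.trans (Nat.floor_le_floor ?_)
    apply Real.rpow_le_rpow_of_exponent_le _ (le_max_left _ _)
    exact_mod_cast (by omega : 1 ≤ i)
  refine (aux_dim (V ^ i) (V ^ n) hP).trans ?_
  exact Nat.pow_le_pow_left (Submodule.finrank_mono (hmono h2)) 2

end
end

section
/- Let A be a simple finitely generated infinite-dimensional K-algebra. Then fd(M) ≥ 1 / (fd(A) + max{fd(A), 1}) for every simple A-module M. -/
/- Common definitions: degree of a function, standard finite-dimensional filtrations,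
Gelfand-Kirillov dimension, return functions and filter dimensions (V. Bavula,
"Filter dimension"), and the Rentschler–Gabriel (left) Krull dimension via deviation. -/

open Filter

noncomputable section

section Helpers

variable {K A : Type} [Field K] [Ring A] [Algebra K A]

lemma hp_pow_mono {V : Submodule K A} (hV : IsStdFilt K A V) {m n : ℕ} (h : m ≤ n) :
    V ^ m ≤ V ^ n := by
  refine pow_le_pow_right₀ ?_ h
  exact Submodule.one_le.2 hV.one_mem

lemma hp_fin {V : Submodule K A} (hV : IsStdFilt K A V) (n : ℕ) :
    FiniteDimensional K (V ^ n : Submodule K A) := by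
  have := hV.fin
  rw [← Submodule.fg_iff_finiteDimensional] at *
  exact this.pow n

lemma hp_strict (hinf : ¬ FiniteDimensional K A)
    {V : Submodule K A} (hV : IsStdFilt K A V) (n : ℕ) : V ^ n < V ^ (n + 1) := by
  refine lt_of_le_of_ne (hp_pow_mono hV (Nat.le_succ n)) fun h => hinf ?_
  have hst : ∀ k, V ^ (n + k) = V ^ n := by
    intro k
    induction k with
    | zero => rfl
    | succ k ih => rw [← add_assoc, pow_succ, ih, ← pow_succ, ← h]
  have htop : ∀ a : A, a ∈ V ^ n → False ∨ a ∈ V ^ n := fun a h => Or.inr h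
  have key : ∀ a : A, ∃ k, a ∈ V ^ k := by
    intro a
    have ha : a ∈ Algebra.adjoin K (V : Set A) := by rw [hV.gen]; trivial
    induction ha using Algebra.adjoin_induction with
    | mem x hx => exact ⟨1, by simpa using hx⟩
    | algebraMap r => exact ⟨0, by simp⟩
    | add x y _ _ hx hy =>
      obtain ⟨k, hk⟩ := hx
      obtain ⟨l, hl⟩ := hy
      exact ⟨max k l, add_mem (hp_pow_mono hV (le_max_left _ _) hk)
        (hp_pow_mono hV (le_max_right _ _) hl)⟩
    | mul x y _ _ hx hy =>
      obtain ⟨k, hk⟩ := hx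
      obtain ⟨l, hl⟩ := hy
      exact ⟨k + l, by rw [pow_add]; exact Submodule.mul_mem_mul hk hl⟩
  have : (V ^ n : Submodule K A) = ⊤ := by
    rw [eq_top_iff]
    rintro a -
    obtain ⟨k, hk⟩ := key a
    rw [← hst k]
    exact hp_pow_mono hV (by omega) hk
  have h1 := hp_fin hV n
  rw [this] at h1
  exact (Submodule.topEquiv (R := K) (M := A)).finiteDimensional

lemma hp_growth (hinf : ¬ FiniteDimensional K A)
    {V : Submodule K A} (hV : IsStdFilt K A V) (n : ℕ) :
    n + 1 ≤ Module.finrank K (V ^ n : Submodule K A) := by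
  induction n with
  | zero =>
    have := hp_fin hV 0
    have hA : Nontrivial A := by
      by_contra h
      rw [not_nontrivial_iff_subsingleton] at h
      exact hinf inferInstance
    rw [zero_add, Submodule.one_le_finrank_iff, pow_zero]
    intro h
    have : (1 : A) ∈ (1 : Submodule K A) := Submodule.one_le.1 le_rfl
    rw [h] at this
    simp at this
  | succ n ih =>
    have := hp_fin hV (n + 1)
    have := Submodule.finrank_lt_finrank_of_lt (hp_strict hinf hV n)
    omega

def PA (V : Submodule K A) (i n : ℕ) : Prop :=
  ∀ a ∈ (V ^ i : Submodule K A), a ≠ 0 →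
    (1 : A) ∈ Submodule.span K
      {x : A | ∃ u ∈ (V ^ n : Submodule K A), ∃ w ∈ (V ^ n : Submodule K A), x = u * a * w}

lemma hp_sInf {P : ℕ → Prop} (hP : ∀ m n, m ≤ n → P m → P n) {n : ℕ}
    (h : sInf {j : ℕ∞ | ∃ n : ℕ, j = (n : ℕ∞) ∧ P n} ≤ n) : P n := by
  have hne : {j : ℕ∞ | ∃ n : ℕ, j = (n : ℕ∞) ∧ P n}.Nonempty := by
    by_contra hh
    rw [Set.not_nonempty_iff_eq_empty] at hh
    rw [hh, sInf_empty] at h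
    simp at h
  obtain ⟨m, hm, hPm⟩ := csInf_mem hne
  rw [hm] at h
  exact hP m n (by exact_mod_cast h) hPm

lemma hp_PA {V : Submodule K A} (hV : IsStdFilt K A V) {i n : ℕ} (h : nuFn K V i ≤ n) :
    PA V i n := by
  refine hp_sInf (P := PA V i) ?_ h
  intro m n hmn hm a ha ha0
  refine Submodule.span_mono ?_ (hm a ha ha0)
  rintro x ⟨u, hu, w, hw, rfl⟩
  exact ⟨u, hp_pow_mono hV hmn hu, w, hp_pow_mono hV hmn hw, rfl⟩

variable {M : Type} [AddCommGroup M] [Module K M] [Module A M] [IsScalarTower K A M]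

def PM (V : Submodule K A) (W : Submodule K M) (i n : ℕ) : Prop :=
  ∀ N : Submodule K M,
      Submodule.span A (N : Set M) = ⊤ → N ≤ smulSub K (V ^ i) W →
      W ≤ smulSub K (V ^ n) N

lemma hp_smulSub_mono {p q : Submodule K A} (h : p ≤ q) (W : Submodule K M) :
    smulSub K p W ≤ smulSub K q W := by
  apply Submodule.span_mono
  rintro x ⟨a, ha, w, hw, rfl⟩
  exact ⟨a, h ha, w, hw, rfl⟩

lemma hp_smul_mem {p : Submodule K A} {W : Submodule K M} {a : A} {w : M} (ha : a ∈ p)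
    (hw : w ∈ W) : a • w ∈ smulSub K p W := Submodule.subset_span ⟨a, ha, w, hw, rfl⟩

lemma hp_PM {V : Submodule K A} (hV : IsStdFilt K A V) {W : Submodule K M} {i n : ℕ}
    (h : retMod K V W i ≤ n) : PM V W i n := by
  refine hp_sInf (P := PM V W i) ?_ h
  intro m n hmn hm N h1 h2
  exact (hm N h1 h2).trans (hp_smulSub_mono (hp_pow_mono hV hmn) N)

lemma hp_smulSub_fin (p : Submodule K A) (W : Submodule K M) (hp : FiniteDimensional K p)
    (hW : FiniteDimensional K W) : FiniteDimensional K (smulSub K p W) := by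
  rw [← Submodule.fg_iff_finiteDimensional] at *
  have := Submodule.FG.map₂ (Algebra.lsmul K K M : A →ₐ[K] Module.End K M).toLinearMap hp hW
  rw [Submodule.map₂_eq_span_image2] at this
  have heq : {x : M | ∃ a ∈ p, ∃ w ∈ W, x = a • w} = Set.image2 (fun m n =>
      (Algebra.lsmul K K M : A →ₐ[K] Module.End K M).toLinearMap m n) (p : Set A) (W : Set M) := by
    ext x
    constructor
    · rintro ⟨a, ha, w, hw, rfl⟩
      exact ⟨a, ha, w, hw, rfl⟩
    · rintro ⟨a, ha, w, hw, rfl⟩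
      exact ⟨a, ha, w, hw, rfl⟩
  unfold smulSub
  rw [heq]
  exact this

lemma hp_W_ne [Nontrivial M] {W : Submodule K M} (hW : IsGenSub K A W) : ∃ w ∈ W, w ≠ 0 := by
  by_contra! h
  have h2 := hW.2
  rw [Submodule.span_eq_bot.2 (fun x hx => h x hx)] at h2
  exact bot_ne_top h2

lemma hp_A [Nontrivial M] {V : Submodule K A} (hV : IsStdFilt K A V) {W : Submodule K M}
    (hW : IsGenSub K A W) {i n : ℕ} (h : PA V i n) :
    Module.finrank K (V ^ i : Submodule K A) ≤
      Module.finrank K (smulSub K (V ^ n) W) * Module.finrank K (smulSub K (V ^ (n + i)) W) := by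
  have f1 := hp_fin hV i
  have f2 := hp_smulSub_fin (V ^ n) W (hp_fin hV n) hW.1
  have f3 := hp_smulSub_fin (V ^ (n + i)) W (hp_fin hV (n + i)) hW.1
  have hmem : ∀ a ∈ (V ^ i : Submodule K A), ∀ v ∈ smulSub K (V ^ n) W,
      a • v ∈ smulSub K (V ^ (n + i)) W := by
    intro a ha v hv
    unfold smulSub at hv
    induction hv using Submodule.span_induction with
    | mem x hx =>
      obtain ⟨b, hb, w, hw, rfl⟩ := hx
      rw [← mul_smul]
      refine hp_smul_mem ?_ hw
      rw [add_comm, pow_add]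
      exact Submodule.mul_mem_mul ha hb
    | zero => simp
    | add x y _ _ hx hy => rw [smul_add]; exact add_mem hx hy
    | smul k x _ hx => rw [smul_comm]; exact Submodule.smul_mem _ _ hx
  let φ : (V ^ i : Submodule K A) →ₗ[K]
      (smulSub K (V ^ n) W →ₗ[K] smulSub K (V ^ (n + i)) W) :=
    LinearMap.mk₂ K (fun a v => ⟨(a : A) • (v : M), hmem a a.2 v v.2⟩)
      (by intros; ext; simp [add_smul]) (by intros; ext; simp)
      (by intros; ext; simp) (by intro c a v; ext; exact smul_comm (a : A) c (v : M))
  have hφ : Function.Injective φ := by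
    rw [← LinearMap.ker_eq_bot, LinearMap.ker_eq_bot']
    rintro ⟨a, ha⟩ h0
    by_contra hne
    have ha0 : a ≠ 0 := fun h => hne (by ext; exact h)
    have hz : ∀ v ∈ smulSub K (V ^ n) W, a • v = 0 := by
      intro v hv
      have := congrArg Subtype.val (LinearMap.congr_fun h0 ⟨v, hv⟩)
      exact this
    obtain ⟨w, hw, hw0⟩ := hp_W_ne hW
    have : ∀ x ∈ Submodule.span K
      {x : A | ∃ u ∈ (V ^ n : Submodule K A), ∃ w ∈ (V ^ n : Submodule K A), x = u * a * w},
        x • w = 0 := by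
      intro x hx
      induction hx using Submodule.span_induction with
      | mem x hx =>
        obtain ⟨u, hu, b, hb, rfl⟩ := hx
        rw [mul_smul, mul_smul, hz _ (hp_smul_mem hb hw), smul_zero]
      | zero => simp
      | add x y _ _ hx hy => rw [add_smul, hx, hy, add_zero]
      | smul k x _ hx => rw [smul_assoc, hx, smul_zero]
    have := this 1 (h a ha ha0)
    rw [one_smul] at this
    exact hw0 this
  have := LinearMap.finrank_le_finrank_of_injective hφ
  rwa [Module.finrank_linearMap] at this

lemma hp_B [IsSimpleModule A M] {V : Submodule K A} (hV : IsStdFilt K A V) {W : Submodule K M}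
    (hW : IsGenSub K A W) {i n : ℕ} (h : PM V W i n) :
    Module.finrank K (smulSub K (V ^ i) W) ≤ Module.finrank K (V ^ n : Submodule K A) := by
  have : Nontrivial M := IsSimpleModule.nontrivial A M
  obtain ⟨w, hw, hw0⟩ := hp_W_ne hW
  have f1 := hp_fin hV n
  have f2 := hp_smulSub_fin (V ^ i) W (hp_fin hV i) hW.1
  obtain ⟨f, hf⟩ : ∃ f : Module.Dual K M, f w ≠ 0 := by
    by_contra! hh
    exact hw0 ((Module.forall_dual_apply_eq_zero_iff K w).1 hh)
  let φ : smulSub K (V ^ i) W →ₗ[K] Module.Dual K (V ^ n : Submodule K A) :=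
    LinearMap.mk₂ K (fun v a => f ((a : A) • (v : M)))
      (by intros; simp) (by intro c v a; change f ((a : A) • c • (v : M)) = _; rw [smul_comm, map_smul])
      (by intros; simp [add_smul]) (by intros; simp)
  have hφ : Function.Injective φ := by
    rw [← LinearMap.ker_eq_bot, LinearMap.ker_eq_bot']
    rintro ⟨v, hv⟩ h0
    by_contra hne
    have hv0 : v ≠ 0 := fun h => hne (by ext; exact h)
    have hz : ∀ a ∈ (V ^ n : Submodule K A), f (a • v) = 0 := fun a ha =>
      LinearMap.congr_fun h0 ⟨a, ha⟩
    have hN := h (Submodule.span K {v}) ?_ ?_ hw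
    · apply hf
      unfold smulSub at hN
      have hle : Submodule.span K {x : M | ∃ a ∈ (V ^ n : Submodule K A),
          ∃ w ∈ Submodule.span K {v}, x = a • w} ≤ LinearMap.ker f := by
        rw [Submodule.span_le]
        rintro x ⟨a, ha, y, hy, rfl⟩
        obtain ⟨k, rfl⟩ := Submodule.mem_span_singleton.1 hy
        simp [smul_comm a k v, hz a ha]
      exact hle hN
    · rcases eq_bot_or_eq_top (Submodule.span A ((Submodule.span K {v} : Submodule K M) : Set M))
        with h | h
      · exact absurd (Submodule.span_eq_bot.1 h v (Submodule.mem_span_singleton_self v)) hv0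
      · exact h
    · rw [Submodule.span_le]
      simpa using hv
  have := LinearMap.finrank_le_finrank_of_injective hφ
  rwa [Subspace.dual_finrank_eq] at this

lemma hp_M_inf [IsSimpleRing A] [Nontrivial M] (hinf : ¬ FiniteDimensional K A) :
    ¬ FiniteDimensional K M := by
  intro h
  apply hinf
  have : Function.Injective (Algebra.lsmul K K M : A →ₐ[K] Module.End K M).toLinearMap :=
    (Algebra.lsmul K K M : A →ₐ[K] Module.End K M).toRingHom.injective
  exact FiniteDimensional.of_injective _ this

lemma hp_M_two [IsSimpleRing A] [Nontrivial M] (hinf : ¬ FiniteDimensional K A)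
    {V : Submodule K A} (hV : IsStdFilt K A V) {W : Submodule K M}
    (hW : IsGenSub K A W) {i : ℕ} (hi : 1 ≤ i) :
    1 < Module.finrank K (smulSub K (V ^ i) W) := by
  by_contra! hle
  have f2 := hp_smulSub_fin (V ^ i) W (hp_fin hV i) hW.1
  have f3 := hW.1
  have hWle : W ≤ smulSub K (V ^ i) W := by
    intro w hw
    rw [← one_smul A w]
    exact hp_smul_mem (Submodule.one_le.1 (by simpa using hp_pow_mono hV (Nat.zero_le i))) hw
  have h1 : 1 ≤ Module.finrank K W := by
    obtain ⟨w, hw, hw0⟩ := hp_W_ne hW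
    rw [Submodule.one_le_finrank_iff]
    rintro rfl
    exact hw0 (by simpa using hw)
  have heq : W = smulSub K (V ^ i) W := Submodule.eq_of_le_of_finrank_le hWle (by omega)
  have hst : ∀ a : A, ∀ w ∈ W, a • w ∈ W := by
    intro a
    have ha : a ∈ Algebra.adjoin K (V : Set A) := by rw [hV.gen]; trivial
    induction ha using Algebra.adjoin_induction with
    | mem x hx =>
      intro w hw
      rw [heq]
      exact hp_smul_mem (hp_pow_mono hV hi (by simpa using hx)) hw
    | algebraMap r => intro w hw; rw [algebraMap_smul]; exact W.smul_mem r hw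
    | add x y _ _ hx hy => intro w hw; rw [add_smul]; exact add_mem (hx w hw) (hy w hw)
    | mul x y _ _ hx hy => intro w hw; rw [mul_smul]; exact hx _ (hy w hw)
  have htop : W = ⊤ := by
    rw [eq_top_iff]
    rintro m -
    have hm : m ∈ Submodule.span A (W : Set M) := by rw [hW.2]; trivial
    induction hm using Submodule.span_induction with
    | mem x hx => exact hx
    | zero => exact zero_mem _
    | add x y _ _ hx hy => exact add_mem hx hy
    | smul k x _ hx => exact hst k x hx
  rw [htop] at f3
  exact hp_M_inf (A := A) (M := M) hinf
    (Submodule.topEquiv (R := K) (M := M)).finiteDimensional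

end Helpers

lemma hp_floor_neg {r : ℝ} (hr : r < 0) {i : ℕ} (hi : 2 ≤ i) : ⌊(i : ℝ) ^ r⌋₊ = 0 := by
  rw [Nat.floor_eq_zero]
  exact Real.rpow_lt_one_of_one_lt_of_neg (by exact_mod_cast hi) hr

/-- analytic core -/
lemma hp_core (a : ℕ → ℕ) (ha : ∀ n, n + 1 ≤ a n) {α β : ℝ} (hα : 0 < α) (hβ : 0 < β)
    (hαβ : α + β < 1)
    (h : ∀ᶠ i : ℕ in atTop, a i ≤ a ⌊(i : ℝ) ^ α⌋₊ * a ⌊(i : ℝ) ^ β⌋₊) : False := by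
  obtain ⟨s, hs0, hs1, hs⟩ : ∃ s : ℝ, 0 < s ∧ s < 1 ∧ α ^ s + β ^ s < 1 := by
    have hc : ContinuousAt (fun s : ℝ => α ^ s + β ^ s) 1 :=
      (Real.continuousAt_const_rpow hα.ne').add (Real.continuousAt_const_rpow hβ.ne')
    have he : ∀ᶠ s in nhds (1 : ℝ), α ^ s + β ^ s < 1 :=
      hc.eventually_lt continuousAt_const (by simpa using hαβ)
    have h0 : ∀ᶠ s in nhds (1 : ℝ), 0 < s := lt_mem_nhds one_pos
    obtain ⟨s, ⟨h1, h2⟩, h3⟩ := ((he.and h0).filter_mono nhdsWithin_le_nhds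
      |>.and (self_mem_nhdsWithin (a := (1 : ℝ)) (s := Set.Iio 1))).exists
    exact ⟨s, h2, h3, h1⟩
  have hbig : ∀ δ : ℝ, 0 < δ → ∀ᶠ i : ℕ in atTop, (2 : ℝ) ≤ (i : ℝ) ^ δ := fun δ hδ =>
    ((tendsto_rpow_atTop hδ).comp tendsto_natCast_atTop_atTop).eventually_ge_atTop 2
  obtain ⟨i₀, hi₀⟩ := eventually_atTop.1 (h.and ((hbig α hα).and (hbig β hβ)))
  have hl2 : 0 < Real.log 2 := Real.log_pos (by norm_num)
  have hapos : ∀ n, (0 : ℝ) < a n := fun n => by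
    have := ha n
    exact_mod_cast (by omega : 0 < a n)
  have hLnn : ∀ n, 0 ≤ Real.log (a n) := fun n => Real.log_natCast_nonneg _
  obtain ⟨C, hC0, hC⟩ : ∃ C : ℝ, 0 ≤ C ∧ ∀ i < i₀, Real.log (a i) ≤ C * (Real.log 2) ^ s := by
    refine ⟨(∑ i ∈ Finset.range i₀, Real.log (a i)) / (Real.log 2) ^ s,
      div_nonneg (Finset.sum_nonneg fun i _ => hLnn i) (Real.rpow_nonneg hl2.le _), ?_⟩
    intro i hi
    rw [div_mul_cancel₀ _ (Real.rpow_pos_of_pos hl2 s).ne']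
    exact Finset.single_le_sum (f := fun i => Real.log (a i)) (fun i _ => hLnn i)
      (Finset.mem_range.2 hi)
  have main : ∀ i : ℕ, 2 ≤ i → Real.log (a i) ≤ C * (Real.log i) ^ s := by
    intro i
    induction i using Nat.strong_induction_on with
    | _ i ih =>
      intro hi
      have hi' : (2 : ℝ) ≤ i := by exact_mod_cast hi
      have hli : Real.log 2 ≤ Real.log i := Real.log_le_log (by norm_num) hi'
      by_cases hlt : i < i₀
      · refine (hC i hlt).trans ?_
        gcongr
      · obtain ⟨h1, h2, h3⟩ := hi₀ i (not_lt.1 hlt)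
        have step : ∀ δ : ℝ, 0 < δ → δ < 1 → (2 : ℝ) ≤ (i : ℝ) ^ δ →
            Real.log (a ⌊(i : ℝ) ^ δ⌋₊) ≤ C * (Real.log i) ^ s * δ ^ s := by
          intro δ hδ hδ1 hδ2
          have hp2 : 2 ≤ ⌊(i : ℝ) ^ δ⌋₊ := Nat.le_floor (by exact_mod_cast hδ2)
          have hfl : (⌊(i : ℝ) ^ δ⌋₊ : ℝ) ≤ (i : ℝ) ^ δ := Nat.floor_le (by positivity)
          have hplt : ⌊(i : ℝ) ^ δ⌋₊ < i := by
            have : (i : ℝ) ^ δ < (i : ℝ) ^ (1 : ℝ) :=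
              Real.rpow_lt_rpow_of_exponent_lt (by linarith) hδ1
            rw [Real.rpow_one] at this
            exact_mod_cast hfl.trans_lt this
          refine (ih _ hplt hp2).trans ?_
          rw [mul_assoc, ← Real.mul_rpow (by linarith) hδ.le]
          have hle : Real.log (⌊(i : ℝ) ^ δ⌋₊ : ℝ) ≤ Real.log i * δ := by
            rw [mul_comm, ← Real.log_rpow (by linarith)]
            exact Real.log_le_log (by exact_mod_cast (by omega : 0 < ⌊(i : ℝ) ^ δ⌋₊)) hfl
          gcongr
        have hA := step α hα (by linarith) h2
        have hB := step β hβ (by linarith) h3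
        have : Real.log (a i) ≤
            Real.log (a ⌊(i : ℝ) ^ α⌋₊) + Real.log (a ⌊(i : ℝ) ^ β⌋₊) := by
          rw [← Real.log_mul (hapos _).ne' (hapos _).ne']
          exact Real.log_le_log (hapos _) (by exact_mod_cast h1)
        have hX : 0 ≤ C * (Real.log i) ^ s :=
          mul_nonneg hC0 (Real.rpow_nonneg (by linarith) _)
        nlinarith
  have hlog : ∀ᶠ i : ℕ in atTop, C < (Real.log i) ^ (1 - s) :=
    ((tendsto_rpow_atTop (by linarith : 0 < 1 - s)).comp
      (Real.tendsto_log_atTop.comp tendsto_natCast_atTop_atTop)).eventually_gt_atTop C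
  obtain ⟨i, hiC, hi2⟩ := (hlog.and (eventually_ge_atTop 2)).exists
  have hi' : (2 : ℝ) ≤ i := by exact_mod_cast hi2
  have hli : 0 < Real.log i := Real.log_pos (by linarith)
  have h1 := main i hi2
  have h2 : Real.log i ≤ Real.log (a i) := Real.log_le_log (by linarith) (by
    have := ha i
    exact_mod_cast (by omega : i ≤ a i))
  have h3 : Real.log i = (Real.log i) ^ (1 - s) * (Real.log i) ^ s := by
    rw [← Real.rpow_add hli]; simp
  have h4 : 0 < (Real.log i) ^ s := Real.rpow_pos_of_pos hli s
  nlinarith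

lemma hp_evmono {f : ℕ → ℕ∞} {r r' : ℝ} (hr : r ≤ r')
    (h : ∀ᶠ i in atTop, f i ≤ (⌊(i : ℝ) ^ r⌋₊ : ℕ∞)) :
    ∀ᶠ i in atTop, f i ≤ (⌊(i : ℝ) ^ r'⌋₊ : ℕ∞) := by
  filter_upwards [h, eventually_ge_atTop 1] with i hi h1
  refine hi.trans ?_
  exact_mod_cast Nat.floor_mono
    (Real.rpow_le_rpow_of_exponent_le (by exact_mod_cast h1) hr)

lemma hp_fdA_nonneg {K A : Type} [Field K] [Ring A] [Algebra K A]
    (hinf : ¬ FiniteDimensional K A)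
    {V : Submodule K A} (hV : IsStdFilt K A V) : 0 ≤ fdAlg K V := by
  apply le_sInf
  rintro _ ⟨r, rfl, hr⟩
  by_contra! hlt
  have hr0 : r < 0 := by exact_mod_cast hlt
  obtain ⟨i, hi, hi2⟩ := (hr.and (eventually_ge_atTop 2)).exists
  rw [hp_floor_neg hr0 hi2] at hi
  have hP : PA V i 0 := hp_PA hV (by simpa using hi)
  have hle : (V ^ i : Submodule K A) ≤ V ^ 0 := by
    intro a ha
    by_cases ha0 : a = 0
    · rw [ha0]; exact zero_mem _
    have h1 := hP a ha ha0
    have h2 : Submodule.span K {x : A | ∃ u ∈ (V ^ 0 : Submodule K A),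
        ∃ w ∈ (V ^ 0 : Submodule K A), x = u * a * w} ≤ Submodule.span K {a} := by
      rw [Submodule.span_le]
      rintro x ⟨u, hu, w, hw, rfl⟩
      rw [pow_zero, Submodule.mem_one] at hu hw
      obtain ⟨k, rfl⟩ := hu
      obtain ⟨l, rfl⟩ := hw
      refine Submodule.mem_span_singleton.2 ⟨l * k, ?_⟩
      rw [← Algebra.commutes l, ← mul_assoc, ← map_mul, Algebra.smul_def]
    obtain ⟨k, hk⟩ := Submodule.mem_span_singleton.1 (h2 h1)
    have hk0 : k ≠ 0 := by
      rintro rfl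
      rw [zero_smul] at hk
      apply ha0
      rw [← one_mul a, ← hk, zero_mul]
    have : a = k⁻¹ • (1 : A) := by rw [← hk, smul_smul, inv_mul_cancel₀ hk0, one_smul]
    rw [this, pow_zero]
    exact Submodule.smul_mem _ _ (Submodule.one_le.1 le_rfl)
  have := hp_strict hinf hV 0
  exact absurd (this.trans_le (hp_pow_mono hV (by omega : 0 + 1 ≤ i))) (not_lt_of_ge hle)

lemma hp_ret_nonneg {K A : Type} [Field K] [Ring A] [Algebra K A] [IsSimpleRing A]
    (hinf : ¬ FiniteDimensional K A)
    {V : Submodule K A} (hV : IsStdFilt K A V)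
    {M : Type} [AddCommGroup M] [Module K M] [Module A M] [IsScalarTower K A M]
    [IsSimpleModule A M]
    {W : Submodule K M} (hW : IsGenSub K A W) {r : ℝ}
    (hr : ∀ᶠ i in atTop, retMod K V W i ≤ (⌊(i : ℝ) ^ r⌋₊ : ℕ∞)) : 0 ≤ r := by
  by_contra! hr0
  have : Nontrivial M := IsSimpleModule.nontrivial A M
  obtain ⟨i, hi, hi2⟩ := (hr.and (eventually_ge_atTop 2)).exists
  rw [hp_floor_neg hr0 hi2] at hi
  have hP : PM V W i 0 := hp_PM hV (by simpa using hi)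
  have h1 := hp_B hV hW hP
  have h2 := hp_M_two (M := M) hinf hV hW (by omega : 1 ≤ i)
  have h3 : Module.finrank K (V ^ 0 : Submodule K A) ≤ 1 := by
    rw [pow_zero, Submodule.one_eq_span]
    exact (finrank_span_le_card _).trans (by simp)
  omega

lemma hp_key {K A : Type} [Field K] [Ring A] [Algebra K A] [IsSimpleRing A]
    (hinf : ¬ FiniteDimensional K A)
    {V : Submodule K A} (hV : IsStdFilt K A V)
    {M : Type} [AddCommGroup M] [Module K M] [Module A M] [IsScalarTower K A M]
    [IsSimpleModule A M]
    {W : Submodule K M} (hW : IsGenSub K A W) {c e r : ℝ} (hc : 0 < c) (hcr : 0 < r)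
    (hce : c < e) (h1e : 1 < e) (hlt : c * r + e * r < 1)
    (hA : ∀ᶠ i in atTop, nuFn K V i ≤ (⌊(i : ℝ) ^ c⌋₊ : ℕ∞))
    (hM : ∀ᶠ i in atTop, retMod K V W i ≤ (⌊(i : ℝ) ^ r⌋₊ : ℕ∞)) : False := by
  have : Nontrivial M := IsSimpleModule.nontrivial A M
  have hmono : ∀ m n, m ≤ n → Module.finrank K (V ^ m : Submodule K A) ≤
      Module.finrank K (V ^ n : Submodule K A) := fun m n hmn => by
    have := hp_fin hV n
    exact Submodule.finrank_mono (hp_pow_mono hV hmn)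
  refine hp_core (fun n => Module.finrank K (V ^ n : Submodule K A)) (hp_growth hinf hV)
    (mul_pos hc hcr) (mul_pos (hc.trans hce) hcr) hlt ?_
  have hfl : ∀ δ : ℝ, 0 < δ → Tendsto (fun i : ℕ => ⌊(i : ℝ) ^ δ⌋₊) atTop atTop := fun δ hδ =>
    tendsto_nat_floor_atTop.comp ((tendsto_rpow_atTop hδ).comp tendsto_natCast_atTop_atTop)
  have hsum : ∀ᶠ i : ℕ in atTop, ⌊(i : ℝ) ^ c⌋₊ + i ≤ ⌊(i : ℝ) ^ e⌋₊ := by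
    have t : ∀ δ : ℝ, 0 < δ → ∀ᶠ i : ℕ in atTop, (2 : ℝ) ≤ (i : ℝ) ^ δ := fun δ hδ =>
      ((tendsto_rpow_atTop hδ).comp tendsto_natCast_atTop_atTop).eventually_ge_atTop 2
    filter_upwards [t (e - c) (by linarith), t (e - 1) (by linarith), eventually_ge_atTop 1]
      with i h1 h2 h3
    have hi : (0 : ℝ) < i := by exact_mod_cast h3
    apply Nat.le_floor
    push_cast
    have e1 : (i : ℝ) ^ e = (i : ℝ) ^ (e - c) * (i : ℝ) ^ c := by
      rw [← Real.rpow_add hi]; simp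
    have e2 : (i : ℝ) ^ e = (i : ℝ) ^ (e - 1) * i := by
      rw [← Real.rpow_add_one hi.ne']; simp
    have e3 : (⌊(i : ℝ) ^ c⌋₊ : ℝ) ≤ (i : ℝ) ^ c := Nat.floor_le (by positivity)
    have e4 : 0 < (i : ℝ) ^ c := by positivity
    nlinarith
  filter_upwards [hA, (hfl c hc).eventually hM, (hfl e (hc.trans hce)).eventually hM, hsum]
    with i h1 h2 h3 h4
  have hfe : ∀ δ : ℝ, ⌊((⌊(i : ℝ) ^ δ⌋₊ : ℕ) : ℝ) ^ r⌋₊ ≤ ⌊(i : ℝ) ^ (δ * r)⌋₊ := by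
    intro δ
    apply Nat.floor_mono
    rw [Real.rpow_mul (by positivity)]
    exact Real.rpow_le_rpow (by positivity) (Nat.floor_le (by positivity)) hcr.le
  refine (hp_A hV hW (hp_PA hV h1)).trans (Nat.mul_le_mul ?_ ?_)
  · exact (hp_B hV hW (hp_PM hV h2)).trans (hmono _ _ (hfe c))
  · have := hp_smulSub_fin (V ^ ⌊(i : ℝ) ^ e⌋₊) W (hp_fin hV _) hW.1
    exact (Submodule.finrank_mono (hp_smulSub_mono (hp_pow_mono hV h4) W)).trans
      ((hp_B hV hW (hp_PM hV h3)).trans (hmono _ _ (hfe e)))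

theorem fd_simple_module_ge
    (K A : Type) [Field K] [Ring A] [Algebra K A] [IsSimpleRing A]
    (hinf : ¬ FiniteDimensional K A)
    (V : Submodule K A) (hV : IsStdFilt K A V)
    (M : Type) [AddCommGroup M] [Module K M] [Module A M] [IsScalarTower K A M]
    [IsSimpleModule A M]
    (W : Submodule K M) (hW : IsGenSub K A W) :
    1 / (fdAlg K V + max (fdAlg K V) 1) ≤ fdModW K V W := by
  apply le_sInf
  rintro _ ⟨r, rfl, hr⟩
  have hr0 : 0 ≤ r := hp_ret_nonneg hinf hV hW hr
  have hd0 := hp_fdA_nonneg hinf hV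
  by_cases htop : fdAlg K V = ⊤
  · rw [htop]
    simpa using hr0
  obtain ⟨d, hd⟩ : ∃ d : ℝ, fdAlg K V = (d : EReal) := by
    refine ⟨(fdAlg K V).toReal, (EReal.coe_toReal htop ?_).symm⟩
    intro hb
    rw [hb] at hd0
    simp at hd0
  rw [hd] at hd0 ⊢
  have hd0' : 0 ≤ d := by exact_mod_cast hd0
  have hcast : (1 : EReal) / ((d : EReal) + max (d : EReal) 1) =
      ((1 / (d + max d 1) : ℝ) : EReal) := by
    rw [EReal.coe_div, EReal.coe_add, EReal.coe_strictMono.monotone.map_max, EReal.coe_one]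
  rw [hcast, EReal.coe_le_coe_iff]
  by_contra! hlt
  have hpos : 0 < d + max d 1 := by positivity
  rw [lt_div_iff₀ hpos] at hlt
  obtain ⟨ε, hε, hεlt⟩ : ∃ ε : ℝ, 0 < ε ∧ (d + max d 1 + 3 * ε) * (r + ε) < 1 := by
    have hc : ContinuousAt (fun ε : ℝ => (d + max d 1 + 3 * ε) * (r + ε)) 0 := by fun_prop
    have he : ∀ᶠ ε in nhds (0 : ℝ), (d + max d 1 + 3 * ε) * (r + ε) < 1 :=
      hc.eventually_lt continuousAt_const (by simpa [mul_comm] using hlt)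
    obtain ⟨ε, h1, h2⟩ := (he.filter_mono nhdsWithin_le_nhds
      |>.and (self_mem_nhdsWithin (a := (0 : ℝ)) (s := Set.Ioi 0))).exists
    exact ⟨ε, h2, h1⟩
  have hA : ∀ᶠ i in atTop, nuFn K V i ≤ (⌊(i : ℝ) ^ (d + ε)⌋₊ : ℕ∞) := by
    have hl : fdAlg K V < ((d + ε : ℝ) : EReal) := by
      rw [hd, EReal.coe_lt_coe_iff]; linarith
    obtain ⟨_, ⟨ρ, rfl, hρ⟩, hρlt⟩ := sInf_lt_iff.1 hl
    exact hp_evmono (by exact_mod_cast hρlt.le) hρ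
  have m1 := le_max_left d 1
  have m2 := le_max_right d 1
  exact hp_key hinf hV hW (c := d + ε) (e := max d 1 + 2 * ε) (r := r + ε) (by linarith)
    (by linarith) (by linarith) (by linarith) (by nlinarith) hA
    (hp_evmono (by linarith) hr)


end
end
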